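/- Let n ≥ 1 and let U and V be open subsets of ℂⁿ. Let A ⊆ U × ℂⁿ be a set that is closed in the subspace topology of U × ℂⁿ, and let A* ⊆ V × ℂⁿ be closed in the subspace topology of V × ℂⁿ. Assume that for every z ∈ U ∩ V the fibers A_z := {w ∈ ℂⁿ : (z,w) ∈ A} and A*_z := {w ∈ ℂⁿ : (z,w) ∈ A*} are finite, satisfy A_z ⊆ A*_z, and have the same cardinality. Then A ∪ A* is closed in the subspace topology of (U ∪ V) × ℂⁿ. -/

import Mathlib

/-- If `A` is relatively closed in the open set `S`, `B` is relatively closed in the open set `T`,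
and `A`, `B` agree over `S ∩ T`, then `A ∪ B` is relatively closed in `S ∪ T`. -/
theorem isClosed_preimage_val_union_of_isOpen {X : Type*} [TopologicalSpace X] {S T A B : Set X}
    (hS : IsOpen S) (hT : IsOpen T)
    (hA : IsClosed (Subtype.val ⁻¹' A : Set S)) (hB : IsClosed (Subtype.val ⁻¹' B : Set T))
    (hBA : B ∩ S ⊆ A) (hAB : A ∩ T ⊆ B) :
    IsClosed (Subtype.val ⁻¹' (A ∪ B) : Set ↥(S ∪ T)) := by
  rw [isClosed_preimage_val] at hA hB ⊢
  rintro x ⟨hx, hcl⟩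
  have hcl' : x ∈ closure (A ∪ B) := closure_mono Set.inter_subset_right hcl
  rcases hx with hx | hx
  · refine Or.inl (hA ⟨hx, closure_mono ?_ (hS.inter_closure ⟨hx, hcl'⟩)⟩)
    rintro y ⟨hyS, hyA | hyB⟩
    exacts [⟨hyS, hyA⟩, ⟨hyS, hBA ⟨hyB, hyS⟩⟩]
  · refine Or.inr (hB ⟨hx, closure_mono ?_ (hT.inter_closure ⟨hx, hcl'⟩)⟩)
    rintro y ⟨hyT, hyA | hyB⟩
    exacts [⟨hyT, hAB ⟨hyA, hyT⟩⟩, ⟨hyT, hyB⟩]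

/-- Gluing lemma for graphs of holomorphic correspondences (topological content of
Lemma 2 of the paper): if `A` is closed in the subspace topology of `U × ℂⁿ`,
`A*` is closed in the subspace topology of `V × ℂⁿ`, and over every point of
`U ∩ V` the fiber of `A` is a finite subset of the fiber of `A*` of the same
cardinality, then `A ∪ A*` is closed in the subspace topology of `(U ∪ V) × ℂⁿ`. -/
theorem union_of_correspondence_graphs_isClosed
    (n : ℕ) (hn : 1 ≤ n)
    (U V : Set (Fin n → ℂ)) (hU : IsOpen U) (hV : IsOpen V)
    (A Astar : Set ((Fin n → ℂ) × (Fin n → ℂ)))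
    (hAsub : A ⊆ U ×ˢ (Set.univ : Set (Fin n → ℂ)))
    (hAstarsub : Astar ⊆ V ×ˢ (Set.univ : Set (Fin n → ℂ)))
    (hAclosed : IsClosed {x : ↥(U ×ˢ (Set.univ : Set (Fin n → ℂ))) | (x : (Fin n → ℂ) × (Fin n → ℂ)) ∈ A})
    (hAstarclosed : IsClosed {x : ↥(V ×ˢ (Set.univ : Set (Fin n → ℂ))) | (x : (Fin n → ℂ) × (Fin n → ℂ)) ∈ Astar})
    (hfin : ∀ z ∈ U ∩ V, ({w : Fin n → ℂ | (z, w) ∈ A}).Finite)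
    (hfinstar : ∀ z ∈ U ∩ V, ({w : Fin n → ℂ | (z, w) ∈ Astar}).Finite)
    (hsub : ∀ z ∈ U ∩ V, {w : Fin n → ℂ | (z, w) ∈ A} ⊆ {w : Fin n → ℂ | (z, w) ∈ Astar})
    (hcard : ∀ z ∈ U ∩ V,
      ({w : Fin n → ℂ | (z, w) ∈ A}).ncard = ({w : Fin n → ℂ | (z, w) ∈ Astar}).ncard) :
    IsClosed {x : ↥((U ∪ V) ×ˢ (Set.univ : Set (Fin n → ℂ))) |
      (x : (Fin n → ℂ) × (Fin n → ℂ)) ∈ A ∪ Astar} := by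
  have hfiber : ∀ z ∈ U ∩ V, {w | (z, w) ∈ A} = {w | (z, w) ∈ Astar} := fun z hz =>
    Set.eq_of_subset_of_ncard_le (hsub z hz) (hcard z hz).ge (hfinstar z hz)
  rw [Set.union_prod]
  refine isClosed_preimage_val_union_of_isOpen (hU.prod isOpen_univ) (hV.prod isOpen_univ)
    hAclosed hAstarclosed ?_ ?_
  · rintro ⟨z, w⟩ ⟨hw, hz⟩
    exact (hfiber z ⟨hz.1, (hAstarsub hw).1⟩).ge hw
  · rintro ⟨z, w⟩ ⟨hw, hz⟩
    exact hsub z ⟨(hAsub hw).1, hz.1⟩ hw
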